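/- Let X be a weakly irreducible, critical multitype Galton-Watson tree whose offspring law 𝒬 satisfies 𝒬{e^{ηN} | a} < ∞ for all a ∈ 𝒳 and η > 0. Then for every A > 0 there exists a compact set K ⊆ ℳ(𝒳 × 𝒳*) such that limsup_{n→∞} (1/n) log P{M_X ∉ K | |T| = n} ≤ −A. -/

import Mathlib

open scoped ENNReal NNReal BigOperators
open Filter

/-- Finite rooted planar trees with vertex types in `𝒳`. -/
inductive PTree (𝒳 : Type*) where
  | node : 𝒳 → List (PTree 𝒳) → PTree 𝒳

namespace PTree

variable {𝒳 : Type*}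

/-- The type of the root. -/
def root : PTree 𝒳 → 𝒳
  | node a _ => a

/-- The list of subtrees rooted at the children of the root (left to right). -/
def children : PTree 𝒳 → List (PTree 𝒳)
  | node _ ts => ts

/-- The types of the children of the root, from left to right. -/
def childLabels (t : PTree 𝒳) : List 𝒳 := t.children.map root

/-- The list of all subtrees `X^v`, `v` a vertex of the tree. -/
def subtrees : PTree 𝒳 → List (PTree 𝒳)
  | node a ts => node a ts :: (ts.attach.map (fun s => subtrees s.1)).flatten
decreasing_by
  have := List.sizeOf_lt_of_mem s.2
  simp only [PTree.node.sizeOf_spec]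
  omega

/-- Number of vertices. -/
def size (t : PTree 𝒳) : ℕ := t.subtrees.length

/-- The vertices at depth exactly `k`, as subtrees, from left to right. -/
def atDepth : ℕ → PTree 𝒳 → List (PTree 𝒳)
  | 0, t => [t]
  | (k+1), node _ ts => (ts.attach.map (fun s => atDepth k s.1)).flatten

/-- Truncation of a tree at height `k` (keeping the generations `0,…,k`). -/
def trunc : ℕ → PTree 𝒳 → PTree 𝒳
  | 0, node a _ => node a []
  | (k+1), node a ts => node a (ts.attach.map (fun s => trunc k s.1))

/-- The height of a tree (largest `k` such that generation `k` is nonempty). -/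
def height : PTree 𝒳 → ℕ
  | node _ [] => 0
  | node _ (t :: ts) => ((t :: ts).attach.map (fun s => height s.1)).foldr max 0 + 1
decreasing_by
  have := List.sizeOf_lt_of_mem s.2
  simp only [PTree.node.sizeOf_spec] at *
  omega

/-- The largest offspring number in the tree. -/
def maxDeg : PTree 𝒳 → ℕ
  | node _ ts => max ts.length (((ts.attach.map (fun s => maxDeg s.1)).foldr max 0))
decreasing_by
  have := List.sizeOf_lt_of_mem s.2
  simp only [PTree.node.sizeOf_spec] at *
  omega

end PTree
noncomputable instance {𝒳 : Type*} : DecidableEq (PTree 𝒳) := Classical.decEq _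

/-- Extended-real logarithm of an extended nonnegative real. -/
noncomputable def elog (x : ℝ≥0∞) : EReal :=
  if x = 0 then ⊥ else if x = ∞ then ⊤ else ((Real.log x.toReal : ℝ) : EReal)

open Classical in
/-- Relative entropy `H(ν ‖ ρ)` of two (probability) vectors on a countable set,
with value `∞` if `ν` is not absolutely continuous with respect to `ρ`.  (For
probability vectors each summand below is nonnegative and the sum equals
`∑ ν a log (ν a / ρ a)`.) -/
noncomputable def relEnt {α : Type*} (ν ρ : α → ℝ) : ℝ≥0∞ :=
  if ∀ a, ρ a = 0 → ν a = 0 then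
    ∑' a, ENNReal.ofReal (ν a * Real.log (ν a / ρ a) + ρ a - ν a)
  else ∞

/-- The Cramér rate function `I_p(x) = sup_λ {λx - log ∑ p(n) e^{λn}}`. -/
noncomputable def cramerRate (p : ℕ → ℝ) (x : ℝ) : EReal :=
  ⨆ lam : ℝ, ((lam * x - Real.log (∑' n : ℕ, p n * Real.exp (lam * n)) : ℝ) : EReal)

/-- Total mass `P{|T| = n}` assigned by the weight `w` to trees with `n` vertices. -/
noncomputable def treeMass {𝒳 : Type*} (w : PTree 𝒳 → ℝ) (n : ℕ) : ℝ≥0∞ :=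
  ∑' t : PTree 𝒳, if t.size = n then ENNReal.ofReal (w t) else 0

open Classical in
/-- Conditional probability of the event `E` given `{|T| = n}`, for the (sub)probability
weight `w` on finite planar trees.  -/
noncomputable def condP {𝒳 : Type*} (w : PTree 𝒳 → ℝ) (n : ℕ) (E : Set (PTree 𝒳)) : ℝ≥0∞ :=
  (∑' t : PTree 𝒳, if t.size = n ∧ t ∈ E then ENNReal.ofReal (w t) else 0) / treeMass w n

/-- The set of sizes having positive probability. -/
noncomputable def sizeSupport {𝒳 : Type*} (w : PTree 𝒳 → ℝ) : Set ℕ := {n | 0 < treeMass w n}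
section Multitype

variable {𝒳 : Type*} [Fintype 𝒳] [DecidableEq 𝒳]

/-- The weight of a typed tree under the multitype Galton-Watson law with initial
distribution `μ0` and offspring kernel `𝒬` (an offspring `c ∈ 𝒳*` is recorded as the
list of types of the children from left to right):
`μ0(root) ∏_v 𝒬{C(v) | type v}`. -/
noncomputable def mgwWeight (μ0 : 𝒳 → ℝ) (𝒬 : 𝒳 → List 𝒳 → ℝ) (t : PTree 𝒳) : ℝ :=
  μ0 t.root * (t.subtrees.map (fun s => 𝒬 s.root s.childLabels)).prod

/-- The multiplicity `m(a,c)` of the symbol `a` in `c ∈ 𝒳*`. -/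
def mult (a : 𝒳) (c : List 𝒳) : ℕ := c.count a

/-- The empirical offspring measure `M_X` of a typed tree. -/
noncomputable def empOff (t : PTree 𝒳) : 𝒳 × List 𝒳 → ℝ := fun x =>
  ((t.subtrees.filter (fun s => s.root = x.1 ∧ s.childLabels = x.2)).length : ℝ) / t.size

/-- The `𝒳`-marginal `ν₁` of a measure on `𝒳 × 𝒳*`. -/
noncomputable def marg1 (ν : 𝒳 × List 𝒳 → ℝ) (a : 𝒳) : ℝ := ∑' c : List 𝒳, ν (a, c)

/-- Shift-invariance: `ν₁(a) = ∑_{(b,c)} m(a,c) ν(b,c)` for all `a`. -/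
def ShiftInv (ν : 𝒳 × List 𝒳 → ℝ) : Prop :=
  ∀ a : 𝒳, marg1 ν a = ∑' x : 𝒳 × List 𝒳, (mult a x.2 : ℝ) * ν x

/-- Membership in `ℳ(𝒳 × 𝒳*)`: a probability measure with finite mean offspring
number. -/
structure IsOffMeasure (ν : 𝒳 × List 𝒳 → ℝ) : Prop where
  nonneg : ∀ x, 0 ≤ ν x
  hasSum : HasSum ν 1
  moment : Summable (fun x : 𝒳 × List 𝒳 => (x.2.length : ℝ) * ν x)

/-- The space `ℳ(𝒳 × 𝒳*)`. -/
def MSpace (𝒳 : Type*) [Fintype 𝒳] [DecidableEq 𝒳] :=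
  {ν : 𝒳 × List 𝒳 → ℝ // IsOffMeasure ν}

/-- The test functions defining the topology of `ℳ(𝒳 × 𝒳*)`: all bounded functions
together with the functions `(b,c) ↦ m(a,c) 𝟙_{b₀}(b)`, `a, b₀ ∈ 𝒳`. -/
def offTests (𝒳 : Type*) [Fintype 𝒳] [DecidableEq 𝒳] : Set ((𝒳 × List 𝒳) → ℝ) :=
  {f | ∃ M : ℝ, ∀ x, |f x| ≤ M} ∪
    {f | ∃ a b₀ : 𝒳, f = fun x => (mult a x.2 : ℝ) * (if x.1 = b₀ then 1 else 0)}

/-- The topology of `ℳ(𝒳 × 𝒳*)`: the smallest topology making `ν ↦ ∫ f dν`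
continuous for every test function `f`. -/
noncomputable instance : TopologicalSpace (MSpace 𝒳) :=
  TopologicalSpace.induced
    (fun ν : MSpace 𝒳 => fun f : offTests 𝒳 => ∑' x, ν.1 x * f.1 x) Pi.topologicalSpace

open Classical in
/-- The rate function `J(ν) = H(ν ‖ ν₁ ⊗ 𝒬)` for shift-invariant `ν`, `∞` otherwise. -/
noncomputable def offRate (𝒬 : 𝒳 → List 𝒳 → ℝ) (ν : 𝒳 × List 𝒳 → ℝ) : ℝ≥0∞ :=
  if ShiftInv ν then relEnt ν (fun x => marg1 ν x.1 * 𝒬 x.1 x.2) else ∞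

/-- The expected offspring matrix `A(a,b) = ∑_c 𝒬{c | b} m(a,c)` (with values in
`[0,∞]`). -/
noncomputable def meanMat (𝒬 : 𝒳 → List 𝒳 → ℝ) : Matrix 𝒳 𝒳 ℝ≥0∞ :=
  Matrix.of fun a b => ∑' c : List 𝒳, ENNReal.ofReal (𝒬 b c) * (mult a c : ℝ≥0∞)

/-- `A* = ∑_{k ≥ 1} A^k`. -/
noncomputable def matStar (A : Matrix 𝒳 𝒳 ℝ≥0∞) : Matrix 𝒳 𝒳 ℝ≥0∞ :=
  Matrix.of fun a b => ∑' k : ℕ, (A ^ (k + 1)) a b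

/-- Weak irreducibility of a nonnegative matrix with respect to a partition of `𝒳`
into recurrent states `Xr` and transient states `Xt`. -/
structure WeaklyIrred (A : Matrix 𝒳 𝒳 ℝ≥0∞) (Xr Xt : Finset 𝒳) : Prop where
  compl : ∀ a, a ∈ Xr ↔ a ∉ Xt
  npty : Xr.Nonempty
  rec_pos : ∀ a b, b ∈ Xr → 0 < matStar A a b
  trans_zero : ∀ a b, b ∈ Xt → a = b ∨ a ∈ Xr → matStar A a b = 0

/-- The real expected offspring matrix. -/
noncomputable def meanMatR (𝒬 : 𝒳 → List 𝒳 → ℝ) : Matrix 𝒳 𝒳 ℝ :=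
  Matrix.of fun a b => ∑' c : List 𝒳, 𝒬 b c * (mult a c : ℝ)

/-- Criticality: the Perron-Frobenius eigenvalue of the expected offspring matrix is
`1`; equivalently (for weakly irreducible matrices) there is a strictly positive right
eigenvector with eigenvalue `1`. -/
def CriticalKernel (𝒬 : 𝒳 → List 𝒳 → ℝ) : Prop :=
  ∃ u : 𝒳 → ℝ, (∀ a, 0 < u a) ∧ ∀ a, ∑ b, meanMatR 𝒬 a b * u b = u a

/-- The uniform bound on the number of transient offspring. -/
def BoundedTransient (𝒬 : 𝒳 → List 𝒳 → ℝ) (Xt : Finset 𝒳) : Prop :=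
  ∃ B : ℕ, ∀ b c, 𝒬 b c ≠ 0 → c.countP (fun a => decide (a ∈ Xt)) ≤ B

end Multitype
namespace PTree

variable {𝒳 : Type*}

theorem induct {P : PTree 𝒳 → Prop} (h : ∀ a ts, (∀ t ∈ ts, P t) → P (node a ts)) :
    ∀ t, P t
  | node a ts => h a ts fun t _ => induct h t
decreasing_by
  have := List.sizeOf_lt_of_mem ‹t ∈ ts›
  simp only [PTree.node.sizeOf_spec]
  omega

theorem subtrees_node (a : 𝒳) (ts : List (PTree 𝒳)) :
    (node a ts).subtrees = node a ts :: (ts.map subtrees).flatten := by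
  rw [subtrees, List.attach_map_val]

theorem size_node (a : 𝒳) (ts : List (PTree 𝒳)) :
    (node a ts).size = 1 + (ts.map size).sum := by
  simp only [size, subtrees_node, List.length_cons, List.length_flatten, List.map_map]
  rw [add_comm]
  rfl

theorem size_pos (t : PTree 𝒳) : 0 < t.size := by
  cases t
  rw [size_node]
  omega

/-- The product over all vertices of a function of the type and the offspring of the vertex. -/
def vertexProd {M : Type*} [CommMonoid M] (q : 𝒳 → List 𝒳 → M) (t : PTree 𝒳) : M :=
  (t.subtrees.map (fun s => q s.root s.childLabels)).prod

theorem vertexProd_node {M : Type*} [CommMonoid M] (q : 𝒳 → List 𝒳 → M) (a : 𝒳)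
    (ts : List (PTree 𝒳)) :
    vertexProd q (node a ts) = q a (ts.map root) * (ts.map (vertexProd q)).prod := by
  simp only [vertexProd, subtrees_node, List.map_cons, List.prod_cons, List.map_flatten,
    List.prod_flatten, List.map_map]
  rfl

theorem vertexProd_nonneg {q : 𝒳 → List 𝒳 → ℝ} (hq : ∀ a c, 0 ≤ q a c) (t : PTree 𝒳) :
    0 ≤ vertexProd q t := by
  apply List.prod_nonneg
  simp only [List.mem_map]
  rintro _ ⟨s, -, rfl⟩
  exact hq _ _

theorem vertexProd_mul {M : Type*} [CommMonoid M] (q r : 𝒳 → List 𝒳 → M) (t : PTree 𝒳) :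
    vertexProd (fun a c => q a c * r a c) t = vertexProd q t * vertexProd r t := by
  simp only [vertexProd, List.prod_map_mul]

theorem vertexProd_const {M : Type*} [CommMonoid M] (m : M) (t : PTree 𝒳) :
    vertexProd (fun _ _ => m) t = m ^ t.size := by
  simp [vertexProd, size]

theorem ofReal_vertexProd {q : 𝒳 → List 𝒳 → ℝ} (hq : ∀ a c, 0 ≤ q a c) (t : PTree 𝒳) :
    ENNReal.ofReal (vertexProd q t) = vertexProd (fun a c => ENNReal.ofReal (q a c)) t := by
  unfold vertexProd
  induction t.subtrees with
  | nil => simp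
  | cons s l ih =>
    simp only [List.map_cons, List.prod_cons]
    rw [ENNReal.ofReal_mul (hq _ _), ih]

/-- A version of `vertexProd` that vanishes on the trees with more than `h` generations. -/
noncomputable def truncProd (q : 𝒳 → List 𝒳 → ℝ≥0∞) : ℕ → PTree 𝒳 → ℝ≥0∞
  | 0, _ => 0
  | h + 1, t => q t.root t.childLabels * (t.children.map (truncProd q h)).prod

theorem vertexProd_le_truncProd (q : 𝒳 → List 𝒳 → ℝ≥0∞) (t : PTree 𝒳) :
    ∀ h, t.size ≤ h → vertexProd q t ≤ truncProd q h t := by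
  induction t using induct with
  | h a ts ih =>
    intro h hh
    rw [size_node] at hh
    obtain ⟨k, rfl⟩ : ∃ k, h = k + 1 := ⟨h - 1, by omega⟩
    rw [vertexProd_node, truncProd]
    refine mul_le_mul' le_rfl (List.Forall₂.prod_le_prod' ?_)
    simp only [children, List.forall₂_map_left_iff, List.forall₂_map_right_iff,
      List.forall₂_same]
    intro t ht
    refine ih t ht k ?_
    have := List.single_le_sum (l := ts.map size) (by simp) _ (List.mem_map_of_mem ht)
    omega

open Classical in
theorem tsum_list_of_map_root (f : PTree 𝒳 → ℝ≥0∞) (c : List 𝒳) :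
    ∑' ts : List (PTree 𝒳), (if ts.map root = c then (ts.map f).prod else 0) =
      (c.map fun x => ∑' t : PTree 𝒳, if t.root = x then f t else 0).prod := by
  induction c with
  | nil =>
    rw [tsum_eq_single []]
    · simp
    · intro ts hts
      simp [hts]
  | cons x c ih =>
    have hinj : Function.Injective (fun p : PTree 𝒳 × List (PTree 𝒳) => p.1 :: p.2) := by
      rintro ⟨a, b⟩ ⟨a', b'⟩ h
      simpa using h
    rw [← hinj.tsum_eq, ENNReal.tsum_prod']
    · simp only [List.map_cons, List.prod_cons, List.cons.injEq]
      rw [← ih, ← ENNReal.tsum_mul_right]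
      refine tsum_congr fun t => ?_
      rw [← ENNReal.tsum_mul_left]
      refine tsum_congr fun ts => ?_
      by_cases h1 : t.root = x <;> by_cases h2 : ts.map root = c <;> simp [h1, h2]
    · intro ts hts
      cases ts with
      | nil => simp at hts
      | cons t ts => exact ⟨(t, ts), rfl⟩

open Classical in
theorem tsum_truncProd_le_one {q : 𝒳 → List 𝒳 → ℝ≥0∞} (hq : ∀ a, ∑' c, q a c ≤ 1) (h : ℕ) :
    ∀ a, ∑' t : PTree 𝒳, (if t.root = a then truncProd q h t else 0) ≤ 1 := by
  induction h with
  | zero => intro a; simp [truncProd]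
  | succ h ih =>
    intro a
    have hinj : Function.Injective (node a) := fun ts ts' hts => by simpa using hts
    rw [← hinj.tsum_eq]
    · have hexpand : ∀ ts : List (PTree 𝒳),
          (if (node a ts).root = a then truncProd q (h + 1) (node a ts) else 0) =
            ∑' c, q a c * if ts.map root = c then (ts.map (truncProd q h)).prod else 0 := by
        intro ts
        rw [tsum_eq_single (ts.map root)]
        · simp [root, truncProd, childLabels, children]
        · intro c hc
          simp [hc.symm]
      rw [tsum_congr hexpand, ENNReal.tsum_comm]
      refine (ENNReal.tsum_le_tsum fun c => ?_).trans (hq a)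
      rw [ENNReal.tsum_mul_left, tsum_list_of_map_root]
      refine mul_le_of_le_one_right' ((List.prod_le_pow_card _ 1 ?_).trans (by simp))
      simp only [List.mem_map]
      rintro _ ⟨x, -, rfl⟩
      exact ih x
    · intro t ht
      cases t with
      | node b ts =>
        have : b = a := by
          by_contra hne
          simp [root, hne] at ht
        exact ⟨ts, by rw [this]⟩

theorem tsum_vertexProd_le_card [Fintype 𝒳] {q : 𝒳 → List 𝒳 → ℝ≥0∞}
    (hq : ∀ a, ∑' c, q a c ≤ 1) :
    ∑' t : PTree 𝒳, vertexProd q t ≤ Fintype.card 𝒳 := by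
  classical
  rw [ENNReal.tsum_eq_iSup_sum]
  refine iSup_le fun F => ?_
  calc ∑ t ∈ F, vertexProd q t
      ≤ ∑ t ∈ F, truncProd q (F.sup size) t :=
        Finset.sum_le_sum fun t ht => vertexProd_le_truncProd q t _ (Finset.le_sup ht)
    _ ≤ ∑' t, truncProd q (F.sup size) t := ENNReal.sum_le_tsum F
    _ = ∑' t : PTree 𝒳, ∑ a, if t.root = a then truncProd q (F.sup size) t else 0 :=
        tsum_congr fun t => by simp
    _ = ∑ a, ∑' t : PTree 𝒳, if t.root = a then truncProd q (F.sup size) t else 0 :=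
        Summable.tsum_finsetSum fun _ _ => ENNReal.summable
    _ ≤ ∑ _a : 𝒳, 1 := Finset.sum_le_sum fun a _ => tsum_truncProd_le_one hq _ a
    _ = Fintype.card 𝒳 := by simp

end PTree

/-- A multiplicatively closed relation between positive integers and positive reals admits an
exponential lower bound. -/
theorem exists_pow_le_of_mul_closed {P : ℕ → ℝ → Prop} (hpos : ∀ k x, P k x → 0 < x)
    (hk : ∀ k x, P k x → 0 < k) (hmul : ∀ k x l y, P k x → P l y → P (k + l) (x * y)) :
    ∃ δ : ℝ, 0 < δ ∧ δ ≤ 1 ∧ ∀ k x, P k x → ∃ y, P k y ∧ δ ^ k ≤ y := by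
  classical
  by_cases hne : ∃ p x, P p x
  swap
  · exact ⟨1, one_pos, le_rfl, fun k x h => absurd ⟨k, x, h⟩ hne⟩
  obtain ⟨p, x₀, hp⟩ := hne
  have hp0 := hk _ _ hp
  have hiter : ∀ j k y, P k y → P (k + j * p) (y * x₀ ^ j) := by
    intro j
    induction j with
    | zero => intro k y h; simpa using h
    | succ j ih =>
      intro k y h
      have := hmul _ _ _ _ (ih k y h) hp
      convert this using 1 <;> ring
  have hres : ∀ r : Fin p, ∃ y : ℝ, 0 < y ∧ ∀ k x, P k x → k % p = r →
      ∃ k₀, k₀ ≤ k ∧ k₀ % p = r ∧ P k₀ y := by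
    intro r
    by_cases hr : ∃ k, (∃ x, P k x) ∧ k % p = r
    · obtain ⟨⟨y, hy⟩, hmod⟩ := Nat.find_spec hr
      exact ⟨y, hpos _ _ hy, fun k x hkx hkr =>
        ⟨Nat.find hr, Nat.find_min' hr ⟨⟨x, hkx⟩, hkr⟩, hmod, hy⟩⟩
    · exact ⟨1, one_pos, fun k x hkx hkr => absurd ⟨k, ⟨x, hkx⟩, hkr⟩ hr⟩
  choose y hy0 hy using hres
  have : Nonempty (Fin p) := ⟨⟨0, hp0⟩⟩
  obtain ⟨r₀, hr₀⟩ := Finite.exists_min y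
  set δ := min (min (y r₀) x₀) 1 with hδ
  have hδ0 : 0 < δ := lt_min (lt_min (hy0 _) (hpos _ _ hp)) one_pos
  have hδ1 : δ ≤ 1 := min_le_right _ _
  refine ⟨δ, hδ0, hδ1, fun k x hkx => ?_⟩
  obtain ⟨k₀, hk₀, hmod, hP⟩ := hy ⟨k % p, Nat.mod_lt _ hp0⟩ k x hkx rfl
  obtain ⟨j, hj⟩ := (Nat.modEq_iff_dvd' hk₀).1 hmod
  have hkj : k = k₀ + j * p := by rw [mul_comm, ← hj]; omega
  have hPk := hiter j _ _ hP
  rw [← hkj] at hPk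
  refine ⟨_, hPk, ?_⟩
  have hjk : j + 1 ≤ k := by
    have := hk _ _ hP
    nlinarith
  calc δ ^ k ≤ δ ^ (j + 1) := pow_le_pow_of_le_one hδ0.le hδ1 hjk
    _ = δ * δ ^ j := by ring
    _ ≤ _ := by
      gcongr
      · exact (hy0 _).le
      · exact ((min_le_left _ _).trans (min_le_left _ _)).trans (hr₀ _)
      · exact (min_le_left _ _).trans (min_le_right _ _)

section Surgery

variable {𝒳 : Type*} {𝒬 : 𝒳 → List 𝒳 → ℝ}

open PTree

/-- The type `a` is the root type of some finite tree of positive weight. -/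
def Mortal (𝒬 : 𝒳 → List 𝒳 → ℝ) (a : 𝒳) : Prop :=
  ∃ t : PTree 𝒳, t.root = a ∧ 0 < vertexProd 𝒬 t

/-- A vertex of type `a` can have a child of type `b`. -/
def HasChild (𝒬 : 𝒳 → List 𝒳 → ℝ) (a b : 𝒳) : Prop := ∃ c, 0 < 𝒬 a c ∧ b ∈ c

/-- Every tree rooted at `b` can be grafted into a tree rooted at `a`, at a fixed cost. -/
def Grafts (𝒬 : 𝒳 → List 𝒳 → ℝ) (a b : 𝒳) : Prop :=
  ∃ (s : ℕ) (q : ℝ), 0 < q ∧ ∀ t : PTree 𝒳, t.root = b →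
    ∃ t' : PTree 𝒳, t'.root = a ∧ t'.size = t.size + s ∧ vertexProd 𝒬 t' = q * vertexProd 𝒬 t

theorem Grafts.refl (a : 𝒳) : Grafts 𝒬 a a :=
  ⟨0, 1, one_pos, fun t ht => ⟨t, ht, by simp, by simp⟩⟩

theorem Grafts.trans {a b c : 𝒳} (hab : Grafts 𝒬 a b) (hbc : Grafts 𝒬 b c) :
    Grafts 𝒬 a c := by
  obtain ⟨s, q, hq, h⟩ := hab
  obtain ⟨s', q', hq', h'⟩ := hbc
  refine ⟨s' + s, q * q', mul_pos hq hq', fun t ht => ?_⟩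
  obtain ⟨t₁, hr₁, hs₁, hw₁⟩ := h' t ht
  obtain ⟨t₂, hr₂, hs₂, hw₂⟩ := h t₁ hr₁
  exact ⟨t₂, hr₂, by omega, by rw [hw₂, hw₁, mul_assoc]⟩

theorem Mortal.of_children {a : 𝒳} {c : List 𝒳} (hc : 0 < 𝒬 a c)
    (h : ∀ b ∈ c, Mortal 𝒬 b) : Mortal 𝒬 a := by
  have hlist : ∃ ts : List (PTree 𝒳), ts.map root = c ∧ 0 < (ts.map (vertexProd 𝒬)).prod := by
    clear hc
    induction c with
    | nil => exact ⟨[], by simp⟩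
    | cons b c ih =>
      obtain ⟨ts, hts, hw⟩ := ih fun x hx => h x (List.mem_cons_of_mem _ hx)
      obtain ⟨t, ht, hw'⟩ := h b List.mem_cons_self
      exact ⟨t :: ts, by simp [ht, hts], by simpa using mul_pos hw' hw⟩
  obtain ⟨ts, hts, hw⟩ := hlist
  exact ⟨node a ts, rfl, by rw [vertexProd_node, hts]; exact mul_pos hc hw⟩

theorem exists_forest (hm : ∀ a, Mortal 𝒬 a) (c : List 𝒳) :
    ∃ ts : List (PTree 𝒳), ts.map root = c ∧ 0 < (ts.map (vertexProd 𝒬)).prod := by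
  choose τ hτ hw using hm
  refine ⟨c.map τ, ?_, List.prod_pos ?_⟩
  · simp [Function.comp_def, hτ]
  · simp only [List.mem_map]
    rintro _ ⟨_, ⟨b, -, rfl⟩, rfl⟩
    exact hw b

theorem HasChild.grafts (hm : ∀ a, Mortal 𝒬 a) {a b : 𝒳} (h : HasChild 𝒬 a b) :
    Grafts 𝒬 a b := by
  obtain ⟨c, hc, hb⟩ := h
  obtain ⟨l, r, rfl⟩ := List.append_of_mem hb
  obtain ⟨L, hL, hLw⟩ := exists_forest hm l
  obtain ⟨R, hR, hRw⟩ := exists_forest hm r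
  refine ⟨1 + (L.map size).sum + (R.map size).sum,
    𝒬 a (l ++ b :: r) * (L.map (vertexProd 𝒬)).prod * (R.map (vertexProd 𝒬)).prod,
    mul_pos (mul_pos hc hLw) hRw, fun t ht => ⟨node a (L ++ t :: R), rfl, ?_, ?_⟩⟩
  · rw [size_node]
    simp only [List.map_append, List.map_cons, List.sum_append, List.sum_cons]
    omega
  · rw [vertexProd_node]
    simp only [List.map_append, List.map_cons, List.prod_append, List.prod_cons, hL, hR, ht]
    ring

theorem exists_graft_two (hm : ∀ a, Mortal 𝒬 a) {a b b' : 𝒳} {l₁ l₂ l₃ : List 𝒳}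
    (hc : 0 < 𝒬 a (l₁ ++ b :: (l₂ ++ b' :: l₃))) :
    ∃ (s : ℕ) (q : ℝ), 0 < q ∧ ∀ t t' : PTree 𝒳, t.root = b → t'.root = b' →
      ∃ u : PTree 𝒳, u.root = a ∧ u.size = t.size + t'.size + s ∧
        vertexProd 𝒬 u = q * (vertexProd 𝒬 t * vertexProd 𝒬 t') := by
  obtain ⟨L, hL, hLw⟩ := exists_forest hm l₁
  obtain ⟨M, hM, hMw⟩ := exists_forest hm l₂
  obtain ⟨R, hR, hRw⟩ := exists_forest hm l₃
  refine ⟨1 + (L.map size).sum + (M.map size).sum + (R.map size).sum,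
    𝒬 a (l₁ ++ b :: (l₂ ++ b' :: l₃)) * (L.map (vertexProd 𝒬)).prod *
      (M.map (vertexProd 𝒬)).prod * (R.map (vertexProd 𝒬)).prod,
    mul_pos (mul_pos (mul_pos hc hLw) hMw) hRw,
    fun t t' ht ht' => ⟨node a (L ++ t :: (M ++ t' :: R)), rfl, ?_, ?_⟩⟩
  · rw [size_node]
    simp only [List.map_append, List.map_cons, List.sum_append, List.sum_cons]
    omega
  · rw [vertexProd_node]
    simp only [List.map_append, List.map_cons, List.prod_append, List.prod_cons, hL, hM, hR,
      ht, ht']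
    ring

theorem grafts_of_reflTransGen (hm : ∀ a, Mortal 𝒬 a) {a b : 𝒳}
    (h : Relation.ReflTransGen (HasChild 𝒬) a b) : Grafts 𝒬 a b := by
  induction h with
  | refl => exact .refl a
  | tail _ hstep ih => exact ih.trans (hstep.grafts hm)

/-- If a tree and a second one of the same root type `a` can be merged at a fixed cost, then all
attainable sizes are attained with at most exponentially small weight. -/
theorem exists_pow_le_of_merge {a : 𝒳}
    (h : ∃ (s : ℕ) (q : ℝ), 0 < q ∧ ∀ t t' : PTree 𝒳, t.root = a → t'.root = a →
      ∃ u : PTree 𝒳, u.root = a ∧ u.size = t.size + t'.size + s ∧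
        vertexProd 𝒬 u = q * (vertexProd 𝒬 t * vertexProd 𝒬 t')) :
    ∃ ρ : ℝ, 0 < ρ ∧ ρ ≤ 1 ∧ ∀ t : PTree 𝒳, t.root = a → 0 < vertexProd 𝒬 t →
      ∃ u : PTree 𝒳, u.root = a ∧ u.size = t.size ∧ ρ ^ t.size ≤ vertexProd 𝒬 u := by
  obtain ⟨s, q, hq, hmerge⟩ := h
  obtain ⟨δ, hδ0, hδ1, hδ⟩ := exists_pow_le_of_mul_closed
    (P := fun k x => ∃ t : PTree 𝒳, t.root = a ∧ t.size + s = k ∧ 0 < vertexProd 𝒬 t ∧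
      x = q * vertexProd 𝒬 t)
    (by rintro k x ⟨t, -, -, ht, rfl⟩; exact mul_pos hq ht)
    (by rintro k x ⟨t, -, rfl, -⟩; have := t.size_pos; omega)
    (by
      rintro k x l y ⟨t, ht, rfl, hw, rfl⟩ ⟨t', ht', rfl, hw', rfl⟩
      obtain ⟨u, hu, hus, huw⟩ := hmerge t t' ht ht'
      refine ⟨u, hu, by omega, ?_, ?_⟩
      · rw [huw]; positivity
      · rw [huw]; ring)
  set κ := min (δ ^ s / q) 1 with hκ
  have hκ0 : 0 < κ := lt_min (by positivity) one_pos
  refine ⟨κ * δ, mul_pos hκ0 hδ0, mul_le_one₀ (min_le_right _ _) hδ0.le hδ1,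
    fun t ht hw => ?_⟩
  obtain ⟨_, ⟨u, hu, hus, huw, rfl⟩, hle⟩ := hδ _ _ ⟨t, ht, rfl, hw, rfl⟩
  refine ⟨u, hu, by omega, ?_⟩
  have h1 : κ ^ t.size ≤ δ ^ s / q :=
    (pow_le_of_le_one hκ0.le (min_le_right _ _) t.size_pos.ne').trans (min_le_left _ _)
  calc (κ * δ) ^ t.size = κ ^ t.size * δ ^ t.size := mul_pow _ _ _
    _ ≤ δ ^ s / q * δ ^ t.size := by gcongr
    _ = δ ^ (t.size + s) / q := by rw [pow_add]; ring
    _ ≤ vertexProd 𝒬 u := by rw [div_le_iff₀ hq]; linarith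

/-- If the offspring numbers of the types reachable from `a` are bounded, then positive weights
are at least exponentially small in the size. -/
theorem exists_pow_le_of_bounded [Finite 𝒳] (hQ : ∀ a c, 0 ≤ 𝒬 a c) (R : Set 𝒳) (D : ℕ)
    (hR : ∀ b ∈ R, ∀ c, 𝒬 b c ≠ 0 → c.length ≤ D ∧ ∀ x ∈ c, x ∈ R) :
    ∃ ρ : ℝ, 0 < ρ ∧ ρ ≤ 1 ∧ ∀ t : PTree 𝒳, t.root ∈ R → 0 < vertexProd 𝒬 t →
      ρ ^ t.size ≤ vertexProd 𝒬 t := by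
  have hfin : {x : 𝒳 × List 𝒳 | x.2.length ≤ D ∧ 0 < 𝒬 x.1 x.2}.Finite :=
    (Set.finite_univ.prod (List.finite_length_le 𝒳 D)).subset fun x hx => ⟨trivial, hx.1⟩
  obtain ⟨ρ, hρ0, hρ1, hρ⟩ : ∃ ρ : ℝ, 0 < ρ ∧ ρ ≤ 1 ∧
      ∀ x ∈ {x : 𝒳 × List 𝒳 | x.2.length ≤ D ∧ 0 < 𝒬 x.1 x.2}, ρ ≤ 𝒬 x.1 x.2 := by
    rcases Set.eq_empty_or_nonempty {x : 𝒳 × List 𝒳 | x.2.length ≤ D ∧ 0 < 𝒬 x.1 x.2}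
      with h0 | hne
    · exact ⟨1, one_pos, le_rfl, by rw [h0]; simp⟩
    · obtain ⟨x₀, hx₀, hmin⟩ := Set.exists_min_image _ (fun x => 𝒬 x.1 x.2) hfin hne
      exact ⟨min (𝒬 x₀.1 x₀.2) 1, lt_min hx₀.2 one_pos, min_le_right _ _,
        fun x hx => (min_le_left _ _).trans (hmin x hx)⟩
  refine ⟨ρ, hρ0, hρ1, fun t => ?_⟩
  induction t using induct with
  | h a ts ih =>
    intro ha hw
    rw [vertexProd_node] at hw ⊢
    have hq : 𝒬 a (ts.map root) ≠ 0 := left_ne_zero_of_mul hw.ne'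
    have hts : (ts.map (vertexProd 𝒬)).prod ≠ 0 := right_ne_zero_of_mul hw.ne'
    obtain ⟨hlen, hmem⟩ := hR a ha _ hq
    rw [size_node, pow_add, pow_one]
    refine mul_le_mul (hρ (a, _) ⟨hlen, (hQ _ _).lt_of_ne' hq⟩) ?_ (by positivity) (hQ _ _)
    clear hq hlen hw ha
    induction ts with
    | nil => simp
    | cons t ts ihts =>
      simp only [List.map_cons, List.prod_cons, List.sum_cons, pow_add] at hts ⊢
      have ht := left_ne_zero_of_mul hts
      refine mul_le_mul (ih t List.mem_cons_self (hmem _ (by simp))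
        ((vertexProd_nonneg hQ t).lt_of_ne' ht)) ?_ (by positivity) (vertexProd_nonneg hQ t)
      exact ihts (fun s hs => ih s (List.mem_cons_of_mem _ hs)) (right_ne_zero_of_mul hts)
        fun x hx => hmem x (by simp only [List.map_cons, List.mem_cons]; exact Or.inr hx)

end Surgery

section LowerBound

open PTree

variable {𝒳 : Type*} [DecidableEq 𝒳] {𝒬 : 𝒳 → List 𝒳 → ℝ}

theorem meanMat_ne_zero_iff {a b : 𝒳} : meanMat 𝒬 a b ≠ 0 ↔ HasChild 𝒬 b a := by
  simp [meanMat, HasChild, mult, ENNReal.tsum_eq_zero, List.count_eq_zero]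

theorem summable_mul_mult (hQ : ∀ a c, 0 ≤ 𝒬 a c)
    (hexp : ∀ (a : 𝒳) (η : ℝ), 0 < η →
      Summable (fun c : List 𝒳 => 𝒬 a c * Real.exp (η * c.length))) (a b : 𝒳) :
    Summable fun c : List 𝒳 => 𝒬 b c * (mult a c : ℝ) := by
  refine (hexp b 1 one_pos).of_nonneg_of_le (fun c => mul_nonneg (hQ _ _) (Nat.cast_nonneg _))
    fun c => mul_le_mul_of_nonneg_left ?_ (hQ _ _)
  have h1 : (mult a c : ℝ) ≤ c.length := by exact_mod_cast List.count_le_length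
  have h2 := Real.add_one_le_exp (1 * (c.length : ℝ))
  linarith

variable [Fintype 𝒳]

theorem reflTransGen_hasChild_of_pow {k : ℕ} :
    ∀ {a b : 𝒳}, (meanMat 𝒬 ^ k) a b ≠ 0 → Relation.ReflTransGen (HasChild 𝒬) b a := by
  induction k with
  | zero =>
    intro a b h
    rw [pow_zero, Matrix.one_apply] at h
    obtain rfl : a = b := by by_contra hne; simp [hne] at h
    exact .refl
  | succ k ih =>
    intro a b h
    rw [pow_succ, Matrix.mul_apply] at h
    obtain ⟨x, -, hx⟩ := Finset.exists_ne_zero_of_sum_ne_zero h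
    exact .head (meanMat_ne_zero_iff.1 (right_ne_zero_of_mul hx)) (ih (left_ne_zero_of_mul hx))

theorem WeaklyIrred.reflTransGen {Xr Xt : Finset 𝒳} (h : WeaklyIrred (meanMat 𝒬) Xr Xt)
    {b : 𝒳} (hb : b ∈ Xr) (a : 𝒳) : Relation.ReflTransGen (HasChild 𝒬) b a := by
  have := (h.rec_pos a b hb).ne'
  simp only [matStar, Matrix.of_apply, ne_eq, ENNReal.tsum_eq_zero, not_forall] at this
  obtain ⟨k, hk⟩ := this
  exact reflTransGen_hasChild_of_pow hk

theorem WeaklyIrred.mem_transient {Xr Xt : Finset 𝒳} (h : WeaklyIrred (meanMat 𝒬) Xr Xt)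
    {b : 𝒳} (hb : b ∈ Xt) {a : 𝒳} (hab : HasChild 𝒬 b a) : a ∈ Xt := by
  by_contra ha
  have h0 := h.trans_zero a b hb (Or.inr ((h.compl a).2 ha))
  simp only [matStar, Matrix.of_apply, ENNReal.tsum_eq_zero] at h0
  exact meanMat_ne_zero_iff.2 hab (by simpa using h0 0)

/-- In the critical case, if the tree started from one recurrent type can be finite, then it can
be finite for every initial type. -/
theorem mortal_of_critical (hQ : ∀ a c, 0 ≤ 𝒬 a c) (hsum : ∀ a, HasSum (𝒬 a) 1)
    (hexp : ∀ (a : 𝒳) (η : ℝ), 0 < η →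
      Summable (fun c : List 𝒳 => 𝒬 a c * Real.exp (η * c.length)))
    {Xr Xt : Finset 𝒳} (hWI : WeaklyIrred (meanMat 𝒬) Xr Xt) (hcrit : CriticalKernel 𝒬)
    {a₀ : 𝒳} (ha₀ : a₀ ∈ Xr) (hm : Mortal 𝒬 a₀) (a : 𝒳) : Mortal 𝒬 a := by
  classical
  obtain ⟨u, hu, hAu⟩ := hcrit
  have hS := summable_mul_mult hQ hexp
  set I := Finset.univ.filter fun a => ¬ Mortal 𝒬 a with hI
  have hA0 : ∀ a b, 0 ≤ meanMatR 𝒬 a b := fun a b =>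
    tsum_nonneg fun c => mul_nonneg (hQ _ _) (Nat.cast_nonneg _)
  have hcol : ∀ b ∈ I, 1 ≤ ∑ a ∈ I, meanMatR 𝒬 a b := by
    intro b hb
    simp only [meanMatR, Matrix.of_apply]
    rw [← Summable.tsum_finsetSum fun a _ => hS a b, ← (hsum b).tsum_eq]
    refine (hsum b).summable.tsum_le_tsum (fun c => ?_) (summable_sum fun a _ => hS a b)
    rw [← Finset.mul_sum]
    rcases (hQ b c).eq_or_lt with h0 | hpos
    · simp [← h0]
    · obtain ⟨x, hxc, hx⟩ : ∃ x ∈ c, ¬ Mortal 𝒬 x := by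
        by_contra hcon
        push Not at hcon
        exact (Finset.mem_filter.1 hb).2 (Mortal.of_children hpos hcon)
      refine le_mul_of_one_le_right hpos.le ?_
      have h1 : (1 : ℝ) ≤ mult x c := by exact_mod_cast List.count_pos_iff.2 hxc
      exact h1.trans (Finset.single_le_sum (f := fun a => (mult a c : ℝ))
        (fun a _ => Nat.cast_nonneg _) (by simp [hI, hx]))
  have htotal : ∑ a ∈ I, u a =
      ∑ b ∈ I, (∑ a ∈ I, meanMatR 𝒬 a b) * u b + ∑ b ∈ Iᶜ, (∑ a ∈ I, meanMatR 𝒬 a b) * u b := by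
    rw [Finset.sum_add_sum_compl]
    simp only [Finset.sum_mul]
    rw [Finset.sum_comm]
    exact Finset.sum_congr rfl fun a _ => (hAu a).symm
  have hge : ∑ a ∈ I, u a ≤ ∑ b ∈ I, (∑ a ∈ I, meanMatR 𝒬 a b) * u b :=
    Finset.sum_le_sum fun b hb => le_mul_of_one_le_left (hu b).le (hcol b hb)
  have hterm : ∀ b ∈ Iᶜ, 0 ≤ (∑ a ∈ I, meanMatR 𝒬 a b) * u b := fun b _ =>
    mul_nonneg (Finset.sum_nonneg fun a _ => hA0 a b) (hu b).le
  have hzero : ∑ b ∈ Iᶜ, (∑ a ∈ I, meanMatR 𝒬 a b) * u b = 0 :=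
    le_antisymm (by linarith) (Finset.sum_nonneg hterm)
  have hclosed : ∀ b a, Mortal 𝒬 b → HasChild 𝒬 b a → Mortal 𝒬 a := by
    rintro b a hb ⟨c, hc, hac⟩
    by_contra ha
    have h1 := (Finset.sum_eq_zero_iff_of_nonneg hterm).1 hzero b (by simp [hI, hb])
    have h2 := (mul_eq_zero.1 h1).resolve_right (hu b).ne'
    have h3 := (Finset.sum_eq_zero_iff_of_nonneg fun a _ => hA0 a b).1 h2 a (by simp [hI, ha])
    have h4 : 𝒬 b c * (mult a c : ℝ) ≤ meanMatR 𝒬 a b :=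
      (hS a b).le_tsum c fun _ _ => mul_nonneg (hQ _ _) (Nat.cast_nonneg _)
    have h5 : (0 : ℝ) < mult a c := by exact_mod_cast List.count_pos_iff.2 hac
    have := mul_pos hc h5
    linarith
  have hreach := hWI.reflTransGen ha₀ a
  induction hreach with
  | refl => exact hm
  | tail _ hstep ih => exact hclosed _ _ ih hstep

theorem exists_append_of_two_le_countP {α : Type*} {p : α → Bool} {l : List α}
    (h : 2 ≤ l.countP p) :
    ∃ (l₁ : List α) (b : α) (l₂ : List α) (b' : α) (l₃ : List α),
      p b ∧ p b' ∧ l = l₁ ++ b :: (l₂ ++ b' :: l₃) := by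
  induction l with
  | nil => simp at h
  | cons x l ih =>
    by_cases hx : p x
    · rw [List.countP_cons_of_pos hx] at h
      obtain ⟨b', hb', hp⟩ := List.countP_pos_iff.1 (show 0 < l.countP p by omega)
      obtain ⟨l₂, l₃, rfl⟩ := List.append_of_mem hb'
      exact ⟨[], x, l₂, b', l₃, hx, hp, rfl⟩
    · rw [List.countP_cons_of_neg hx] at h
      obtain ⟨l₁, b, l₂, b', l₃, hb, hb', rfl⟩ := ih h
      exact ⟨x :: l₁, b, l₂, b', l₃, hb, hb', rfl⟩

/-- All attainable sizes of the tree started from `a` are attained by trees of at most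
exponentially small weight. -/
theorem exists_pow_le_vertexProd (hQ : ∀ a c, 0 ≤ 𝒬 a c) (hsum : ∀ a, HasSum (𝒬 a) 1)
    (hexp : ∀ (a : 𝒳) (η : ℝ), 0 < η →
      Summable (fun c : List 𝒳 => 𝒬 a c * Real.exp (η * c.length)))
    {Xr Xt : Finset 𝒳} (hWI : WeaklyIrred (meanMat 𝒬) Xr Xt)
    (htrans : BoundedTransient 𝒬 Xt) (hcrit : CriticalKernel 𝒬) (a : 𝒳) :
    ∃ ρ : ℝ, 0 < ρ ∧ ρ ≤ 1 ∧ ∀ t : PTree 𝒳, t.root = a → 0 < vertexProd 𝒬 t →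
      ∃ u : PTree 𝒳, u.root = a ∧ u.size = t.size ∧ ρ ^ t.size ≤ vertexProd 𝒬 u := by
  obtain ⟨B, hB⟩ := htrans
  have of_bounded : ∀ (R : Set 𝒳) (D : ℕ), a ∈ R →
      (∀ b ∈ R, ∀ c, 𝒬 b c ≠ 0 → c.length ≤ D ∧ ∀ x ∈ c, x ∈ R) →
      ∃ ρ : ℝ, 0 < ρ ∧ ρ ≤ 1 ∧ ∀ t : PTree 𝒳, t.root = a → 0 < vertexProd 𝒬 t →
        ∃ u : PTree 𝒳, u.root = a ∧ u.size = t.size ∧ ρ ^ t.size ≤ vertexProd 𝒬 u := by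
    intro R D ha hR
    obtain ⟨ρ, h0, h1, h⟩ := exists_pow_le_of_bounded hQ R D hR
    exact ⟨ρ, h0, h1, fun t ht hw => ⟨t, ht, rfl, h t (ht ▸ ha) hw⟩⟩
  have htr : ∀ b ∈ Xt, ∀ c, 𝒬 b c ≠ 0 → ∀ x ∈ c, x ∈ Xt := fun b hb c hc x hx =>
    hWI.mem_transient hb ⟨c, (hQ _ _).lt_of_ne' hc, hx⟩
  by_cases haXt : a ∈ Xt
  · refine of_bounded Xt B haXt fun b hb c hc => ⟨?_, htr b hb c hc⟩
    rw [← List.countP_eq_length (p := fun a => decide (a ∈ Xt)) |>.2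
      (by simpa using htr b hb c hc)]
    exact hB b c hc
  have haXr := (hWI.compl a).2 haXt
  by_cases hma : Mortal 𝒬 a
  swap
  · exact ⟨1, one_pos, le_rfl, fun t ht hw => absurd ⟨t, ht, hw⟩ hma⟩
  have hm := mortal_of_critical hQ hsum hexp hWI hcrit haXr hma
  by_cases hbr : ∃ b c, 𝒬 b c ≠ 0 ∧ 2 ≤ c.countP fun x => !decide (x ∈ Xt)
  · obtain ⟨b, c, hbc, h2⟩ := hbr
    obtain ⟨l₁, x, l₂, y, l₃, hx, hy, rfl⟩ := exists_append_of_two_le_countP h2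
    obtain ⟨s, q, hq, h⟩ := exists_graft_two hm ((hQ _ _).lt_of_ne' hbc)
    obtain ⟨s₁, q₁, hq₁, h₁⟩ := grafts_of_reflTransGen hm (hWI.reflTransGen haXr b)
    obtain ⟨s₂, q₂, hq₂, h₂⟩ := grafts_of_reflTransGen hm
      (hWI.reflTransGen ((hWI.compl x).2 (by simpa using hx)) a)
    obtain ⟨s₃, q₃, hq₃, h₃⟩ := grafts_of_reflTransGen hm
      (hWI.reflTransGen ((hWI.compl y).2 (by simpa using hy)) a)
    refine exists_pow_le_of_merge ⟨s₁ + s + s₂ + s₃, q₁ * q * q₂ * q₃, by positivity,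
      fun t t' ht ht' => ?_⟩
    obtain ⟨v, hv, hvs, hvw⟩ := h₂ t ht
    obtain ⟨v', hv', hvs', hvw'⟩ := h₃ t' ht'
    obtain ⟨w, hw, hws, hww⟩ := h v v' hv hv'
    obtain ⟨z, hz, hzs, hzw⟩ := h₁ w hw
    exact ⟨z, hz, by omega, by rw [hzw, hww, hvw, hvw']; ring⟩
  · push Not at hbr
    refine of_bounded Set.univ (B + 1) trivial fun b _ c hc => ⟨?_, fun _ _ => trivial⟩
    have h1 := hB b c hc
    have h2 := hbr b c hc
    have h3 := List.length_eq_countP_add_countP (fun x => decide (x ∈ Xt)) (l := c)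
    have h4 : c.countP (fun x => !decide (x ∈ Xt)) =
        c.countP (fun x => decide ¬ decide (x ∈ Xt) = true) := by
      congr 1; funext x; simp
    omega

theorem exists_pow_le_treeMass (hQ : ∀ a c, 0 ≤ 𝒬 a c) (hsum : ∀ a, HasSum (𝒬 a) 1)
    (hexp : ∀ (a : 𝒳) (η : ℝ), 0 < η →
      Summable (fun c : List 𝒳 => 𝒬 a c * Real.exp (η * c.length)))
    {Xr Xt : Finset 𝒳} (hWI : WeaklyIrred (meanMat 𝒬) Xr Xt)
    (htrans : BoundedTransient 𝒬 Xt) (hcrit : CriticalKernel 𝒬)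
    {μ0 : 𝒳 → ℝ} (hμ0 : ∀ a, 0 ≤ μ0 a) :
    ∃ ρ : ℝ, 0 < ρ ∧ ∀ n, 0 < treeMass (mgwWeight μ0 𝒬) n →
      ENNReal.ofReal (ρ ^ n) ≤ treeMass (mgwWeight μ0 𝒬) n := by
  have : Nonempty 𝒳 := hWI.npty.to_type
  have hloc : ∀ a, ∃ ρ : ℝ, 0 < ρ ∧ ∀ t : PTree 𝒳, t.root = a → 0 < mgwWeight μ0 𝒬 t →
      ∃ u : PTree 𝒳, u.size = t.size ∧ ρ ^ t.size ≤ mgwWeight μ0 𝒬 u := by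
    intro a
    obtain ⟨ρ, h0, h1, h⟩ := exists_pow_le_vertexProd hQ hsum hexp hWI htrans hcrit a
    rcases (hμ0 a).eq_or_lt with hz | hpos
    · refine ⟨1, one_pos, fun t ht hw => ?_⟩
      simp [mgwWeight, ht, ← hz] at hw
    · refine ⟨min (μ0 a) 1 * ρ, mul_pos (lt_min hpos one_pos) h0, fun t ht hw => ?_⟩
      obtain ⟨u, hu, hus, huw⟩ := h t ht (pos_of_mul_pos_right hw (hμ0 _))
      refine ⟨u, hus, ?_⟩
      rw [mul_pow, mgwWeight, hu]
      refine mul_le_mul ?_ huw (by positivity) (hμ0 a)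
      exact (pow_le_of_le_one (le_min (hμ0 a) zero_le_one) (min_le_right _ _)
        t.size_pos.ne').trans (min_le_left _ _)
  choose ρ hρ0 hρ using hloc
  obtain ⟨a₀, ha₀⟩ := Finite.exists_min ρ
  refine ⟨ρ a₀, hρ0 a₀, fun n hn => ?_⟩
  obtain ⟨t, ht⟩ := ENNReal.tsum_eq_zero.not.1 hn.ne' |> not_forall.1
  obtain ⟨rfl, hw⟩ : t.size = n ∧ 0 < mgwWeight μ0 𝒬 t := by
    simpa using ht
  obtain ⟨u, hus, huw⟩ := hρ _ t rfl hw
  calc ENNReal.ofReal (ρ a₀ ^ t.size) ≤ ENNReal.ofReal (mgwWeight μ0 𝒬 u) :=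
        ENNReal.ofReal_le_ofReal
          ((pow_le_pow_left₀ (hρ0 _).le (ha₀ _) _).trans huw)
    _ = if u.size = t.size then ENNReal.ofReal (mgwWeight μ0 𝒬 u) else 0 := by simp [hus]
    _ ≤ treeMass (mgwWeight μ0 𝒬) t.size := ENNReal.le_tsum u

end LowerBound

section SuperlinearMoment

variable {𝒳 : Type*} [Fintype 𝒳] {𝒬 : 𝒳 → List 𝒳 → ℝ}

/-- If all exponential moments of the offspring number are finite, then so is some
superlinear-exponential moment. -/
theorem exists_superlinear_moment (hQ : ∀ a c, 0 ≤ 𝒬 a c) (hsum : ∀ a, HasSum (𝒬 a) 1)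
    (hexp : ∀ (a : 𝒳) (η : ℝ), 0 < η →
      Summable (fun c : List 𝒳 => 𝒬 a c * Real.exp (η * c.length))) :
    ∃ ψ : ℕ → ℝ, (∀ n, 0 ≤ ψ n) ∧ (∀ k : ℕ, ∃ C : ℝ, ∀ n : ℕ, (k : ℝ) * n ≤ ψ n + C) ∧
      ∀ a, ∑' c : List 𝒳, ENNReal.ofReal (𝒬 a c * Real.exp (ψ c.length)) ≤ 3 := by
  set Z : 𝒳 → ℕ → ℝ := fun a k => ∑' c : List 𝒳, 𝒬 a c * Real.exp ((k + 1 : ℝ) * c.length)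
    with hZ
  have hterm : ∀ (a : 𝒳) (k : ℕ) (c : List 𝒳),
      0 ≤ 𝒬 a c * Real.exp ((k + 1 : ℝ) * c.length) :=
    fun a k c => mul_nonneg (hQ _ _) (Real.exp_pos _).le
  have hZ0 : ∀ a k, 0 ≤ Z a k := fun a k => tsum_nonneg (hterm a k)
  set E : ℕ → ℝ := fun k => 1 + ∑ a, Z a k with hE
  have hE0 : ∀ k, 0 < E k := fun k =>
    add_pos_of_pos_of_nonneg one_pos (Finset.sum_nonneg fun a _ => hZ0 a k)
  have hZE : ∀ a k, Z a k ≤ E k := fun a k =>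
    (Finset.single_le_sum (f := fun a => Z a k) (fun a _ => hZ0 a k)
      (Finset.mem_univ a)).trans (by simp [hE])
  set w : ℕ → ℕ → ℝ := fun k n => (1 / 2) ^ k / E k * Real.exp ((k + 1 : ℝ) * n) with hw
  have hw0 : ∀ k n, 0 < w k n := fun k n =>
    mul_pos (div_pos (by positivity) (hE0 k)) (Real.exp_pos _)
  set g : ℕ → ℝ := fun n => 1 + ∑ k ∈ Finset.range (n + 1), w k n with hg
  have hg1 : ∀ n, 1 ≤ g n := fun n =>
    le_add_of_nonneg_right (Finset.sum_nonneg fun k _ => (hw0 k n).le)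
  have hg0 : ∀ n, 0 < g n := fun n => one_pos.trans_le (hg1 n)
  refine ⟨fun n => Real.log (g n), fun n => Real.log_nonneg (hg1 n), fun k => ?_, fun a => ?_⟩
  · set C := -Real.log ((1 / 2) ^ k / E k) with hC
    refine ⟨max C ((k : ℝ) * k), fun n => ?_⟩
    rcases le_or_gt k n with hkn | hnk
    · have h1 : w k n ≤ g n :=
        (Finset.single_le_sum (f := fun k => w k n) (fun k _ => (hw0 k n).le)
          (Finset.mem_range.2 (Nat.lt_succ_of_le hkn))).trans (by simp [hg])
      have h2 := Real.log_le_log (hw0 k n) h1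
      rw [hw, Real.log_mul (div_pos (by positivity) (hE0 k)).ne' (Real.exp_pos _).ne',
        Real.log_exp] at h2
      have h3 := le_max_left C ((k : ℝ) * k)
      have h4 : (0 : ℝ) ≤ n := Nat.cast_nonneg n
      linarith
    · have h1 : (k : ℝ) * n ≤ k * k := by gcongr
      have h2 := Real.log_nonneg (hg1 n)
      have h3 := le_max_right C ((k : ℝ) * k)
      linarith
  · have hbound : ∀ c : List 𝒳, ENNReal.ofReal (𝒬 a c * Real.exp (Real.log (g c.length))) ≤
        ENNReal.ofReal (𝒬 a c) + ∑' k : ℕ, ENNReal.ofReal ((1 / 2) ^ k / E k) *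
          ENNReal.ofReal (𝒬 a c * Real.exp ((k + 1 : ℝ) * c.length)) := by
      intro c
      rw [Real.exp_log (hg0 _)]
      have : 𝒬 a c * g c.length = 𝒬 a c + ∑ k ∈ Finset.range (c.length + 1),
          (1 / 2) ^ k / E k * (𝒬 a c * Real.exp ((k + 1 : ℝ) * c.length)) := by
        rw [hg, mul_add, mul_one, Finset.mul_sum]
        congr 1
        refine Finset.sum_congr rfl fun k _ => ?_
        simp only [hw]
        ring
      have hcoef : ∀ k, 0 ≤ (1 / 2 : ℝ) ^ k / E k := fun k =>
        (div_pos (by positivity) (hE0 k)).le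
      rw [this, ENNReal.ofReal_add (hQ _ _)
        (Finset.sum_nonneg fun k _ => mul_nonneg (hcoef k) (hterm a k c)),
        ENNReal.ofReal_sum_of_nonneg fun k _ => mul_nonneg (hcoef k) (hterm a k c)]
      gcongr
      refine le_trans (le_of_eq (Finset.sum_congr rfl fun k _ => ?_)) (ENNReal.sum_le_tsum _)
      exact ENNReal.ofReal_mul (hcoef k)
    refine (ENNReal.tsum_le_tsum hbound).trans ?_
    rw [ENNReal.tsum_add, ENNReal.tsum_comm,
      ← ENNReal.ofReal_tsum_of_nonneg (hQ a) (hsum a).summable, (hsum a).tsum_eq]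
    have hk : ∀ k : ℕ, ∑' c : List 𝒳, ENNReal.ofReal ((1 / 2) ^ k / E k) *
        ENNReal.ofReal (𝒬 a c * Real.exp ((k + 1 : ℝ) * c.length)) ≤ (2⁻¹ : ℝ≥0∞) ^ k := by
      intro k
      rw [ENNReal.tsum_mul_left, ← ENNReal.ofReal_tsum_of_nonneg (hterm a k)
        (hexp a (k + 1) (by positivity)),
        ← ENNReal.ofReal_mul (div_pos (by positivity) (hE0 k)).le]
      have h2 : (2⁻¹ : ℝ≥0∞) ^ k = ENNReal.ofReal ((1 / 2) ^ k) := by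
        rw [ENNReal.ofReal_pow (by norm_num), one_div, ENNReal.ofReal_inv_of_pos two_pos]
        simp
      rw [h2]
      refine ENNReal.ofReal_le_ofReal ?_
      rw [div_mul_eq_mul_div, div_le_iff₀ (hE0 k)]
      exact mul_le_mul_of_nonneg_left (hZE a k) (by positivity)
    calc _ ≤ ENNReal.ofReal 1 + ∑' k : ℕ, (2⁻¹ : ℝ≥0∞) ^ k := by
          gcongr with k
          exact hk k
      _ = 3 := by
          rw [ENNReal.tsum_geometric_two, ENNReal.ofReal_one]
          norm_num

end SuperlinearMoment

section Compactness

variable {𝒳 : Type*}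

/-- Subprobability vectors whose `ψ`-moment is at most `L`. -/
def momentBall (ψ : ℕ → ℝ) (L : ℝ) : Set (𝒳 × List 𝒳 → ℝ) :=
  Set.univ.pi (fun _ => Set.Icc 0 1) ∩
    {ν | ∀ F : Finset (𝒳 × List 𝒳), ∑ x ∈ F, ψ x.2.length * ν x ≤ L}

theorem isCompact_momentBall (ψ : ℕ → ℝ) (L : ℝ) :
    IsCompact (momentBall ψ L : Set (𝒳 × List 𝒳 → ℝ)) := by
  refine (isCompact_univ_pi fun _ => isCompact_Icc).inter_right ?_
  simp only [Set.ofPred_forall]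
  exact isClosed_iInter fun F => isClosed_le (by fun_prop) continuous_const

variable {ψ : ℕ → ℝ} {L : ℝ}

theorem momentBall.nonneg {ν : 𝒳 × List 𝒳 → ℝ} (h : ν ∈ momentBall ψ L) (x) : 0 ≤ ν x :=
  (h.1 x trivial).1

theorem momentBall.summable (hψ : ∀ n, 0 ≤ ψ n) {ν : 𝒳 × List 𝒳 → ℝ}
    (h : ν ∈ momentBall ψ L) : Summable fun x => ψ x.2.length * ν x :=
  summable_of_sum_le (fun x => mul_nonneg (hψ _) (momentBall.nonneg h x)) h.2

/-- Functions of linear growth are negligible with respect to `ψ` off a finite set. -/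
theorem exists_finset_abs_le [Finite 𝒳]
    (hlin : ∀ k : ℕ, ∃ C : ℝ, ∀ n : ℕ, (k : ℝ) * n ≤ ψ n + C)
    {f : 𝒳 × List 𝒳 → ℝ} {M : ℝ} (hf : ∀ x, |f x| ≤ M * (1 + x.2.length)) {ε : ℝ}
    (hε : 0 < ε) :
    ∃ F₀ : Finset (𝒳 × List 𝒳), ∀ x ∉ F₀, |f x| ≤ ε * ψ x.2.length := by
  obtain ⟨k, hk⟩ := exists_nat_ge (2 * (|M| / ε))
  obtain ⟨C, hC⟩ := hlin (k + 1)
  obtain ⟨R, hR⟩ := exists_nat_ge (C + 2 * (|M| / ε))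
  have hfin : {x : 𝒳 × List 𝒳 | x.2.length ≤ R}.Finite :=
    (Set.finite_univ.prod (List.finite_length_le 𝒳 R)).subset fun x hx => ⟨trivial, hx⟩
  refine ⟨hfin.toFinset, fun x hx => ?_⟩
  simp only [Set.Finite.mem_toFinset, Set.mem_ofPred_eq, not_le] at hx
  have h1 := hC x.2.length
  have hx' : (R : ℝ) ≤ x.2.length := by exact_mod_cast hx.le
  set n : ℝ := ((x.2.length : ℕ) : ℝ)
  have hn : 0 ≤ n := Nat.cast_nonneg _
  have hM : 0 ≤ |M| / ε := by positivity
  push_cast at h1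
  have h2 : |M| / ε * (1 + n) ≤ ψ x.2.length := by
    have h3 : 2 * (|M| / ε) * n ≤ k * n := by gcongr
    have h4 : 0 ≤ |M| / ε * n := by positivity
    nlinarith
  calc |f x| ≤ M * (1 + n) := hf x
    _ ≤ |M| * (1 + n) := by gcongr; exact le_abs_self M
    _ = ε * (|M| / ε * (1 + n)) := by field_simp
    _ ≤ ε * ψ x.2.length := by gcongr

theorem momentBall.summable_mul [Finite 𝒳] (hψ : ∀ n, 0 ≤ ψ n)
    (hlin : ∀ k : ℕ, ∃ C : ℝ, ∀ n : ℕ, (k : ℝ) * n ≤ ψ n + C)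
    {f : 𝒳 × List 𝒳 → ℝ} {M : ℝ} (hf : ∀ x, |f x| ≤ M * (1 + x.2.length))
    {ν : 𝒳 × List 𝒳 → ℝ} (h : ν ∈ momentBall ψ L) : Summable fun x => ν x * f x := by
  obtain ⟨F₀, hF₀⟩ := exists_finset_abs_le hlin hf one_pos
  refine Summable.of_norm_bounded_eventually (momentBall.summable hψ h) ?_
  refine F₀.finite_toSet.subset fun x hx => ?_
  by_contra hxF
  apply hx
  have := hF₀ x hxF
  change |ν x * f x| ≤ ψ x.2.length * ν x
  rw [abs_mul, abs_of_nonneg (momentBall.nonneg h x), mul_comm]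
  exact mul_le_mul_of_nonneg_right (by linarith) (momentBall.nonneg h x)

theorem continuousOn_tsum_momentBall [Finite 𝒳] (hψ : ∀ n, 0 ≤ ψ n)
    (hlin : ∀ k : ℕ, ∃ C : ℝ, ∀ n : ℕ, (k : ℝ) * n ≤ ψ n + C)
    {f : 𝒳 × List 𝒳 → ℝ} {M : ℝ} (hf : ∀ x, |f x| ≤ M * (1 + x.2.length)) :
    ContinuousOn (fun ν : 𝒳 × List 𝒳 → ℝ => ∑' x, ν x * f x) (momentBall ψ L) := by
  classical
  have hunif : TendstoUniformlyOn
      (fun (F : Finset (𝒳 × List 𝒳)) (ν : 𝒳 × List 𝒳 → ℝ) => ∑ x ∈ F, ν x * f x)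
      (fun ν => ∑' x, ν x * f x) atTop (momentBall ψ L) := by
    rw [Metric.tendstoUniformlyOn_iff]
    intro ε hε
    obtain ⟨F₀, hF₀⟩ := exists_finset_abs_le hlin hf
      (show 0 < ε / (2 * (|L| + 1)) by positivity)
    filter_upwards [eventually_ge_atTop F₀] with F hF ν hν
    have hle : ∀ G : Finset (𝒳 × List 𝒳), F ⊆ G →
        |∑ x ∈ G, ν x * f x - ∑ x ∈ F, ν x * f x| ≤ ε / 2 := by
      intro G hG
      rw [← Finset.sum_sdiff hG, add_sub_cancel_right]
      calc |∑ x ∈ G \ F, ν x * f x| ≤ ∑ x ∈ G \ F, |ν x * f x| := Finset.abs_sum_le_sum_abs _ _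
        _ ≤ ∑ x ∈ G \ F, ε / (2 * (|L| + 1)) * (ψ x.2.length * ν x) := by
            refine Finset.sum_le_sum fun x hx => ?_
            have hxF : x ∉ F₀ := fun hx0 => (Finset.mem_sdiff.1 hx).2 (hF hx0)
            rw [abs_mul, abs_of_nonneg (momentBall.nonneg hν x), ← mul_assoc, mul_comm]
            exact mul_le_mul_of_nonneg_right (hF₀ x hxF) (momentBall.nonneg hν x)
        _ = ε / (2 * (|L| + 1)) * ∑ x ∈ G \ F, ψ x.2.length * ν x := (Finset.mul_sum _ _ _).symm
        _ ≤ ε / (2 * (|L| + 1)) * (|L| + 1) := by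
            gcongr
            exact (hν.2 _).trans ((le_abs_self L).trans (by linarith))
        _ = ε / 2 := by field_simp
    have hlim : Tendsto (fun G : Finset (𝒳 × List 𝒳) =>
        |∑ x ∈ G, ν x * f x - ∑ x ∈ F, ν x * f x|) atTop
        (nhds |∑' x, ν x * f x - ∑ x ∈ F, ν x * f x|) :=
      ((momentBall.summable_mul hψ hlin hf hν).hasSum.sub_const _).abs
    rw [Real.dist_eq]
    refine (le_of_tendsto hlim ?_).trans_lt (half_lt_self hε)
    filter_upwards [eventually_ge_atTop F] with G hG using hle G hG
  refine hunif.continuousOn (Frequently.of_forall fun F => ?_)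
  fun_prop

/-- The sublevel sets of a superlinear moment are compact in `ℳ(𝒳 × 𝒳*)`. -/
theorem isCompact_moment_le [Fintype 𝒳] [DecidableEq 𝒳] (hψ : ∀ n, 0 ≤ ψ n)
    (hlin : ∀ k : ℕ, ∃ C : ℝ, ∀ n : ℕ, (k : ℝ) * n ≤ ψ n + C) (L : ℝ) :
    IsCompact {ν : MSpace 𝒳 | ∀ F : Finset (𝒳 × List 𝒳),
      ∑ x ∈ F, ψ x.2.length * ν.1 x ≤ L} := by
  have hgrowth : ∀ f : offTests 𝒳, ∃ M : ℝ, ∀ x, |f.1 x| ≤ M * (1 + x.2.length) := by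
    rintro ⟨f, ⟨M, hM⟩ | ⟨a, b₀, rfl⟩⟩
    · refine ⟨M, fun x => (hM x).trans ?_⟩
      have h0 : 0 ≤ M := (abs_nonneg _).trans (hM x)
      have h1 : (0 : ℝ) ≤ x.2.length := Nat.cast_nonneg _
      nlinarith
    · refine ⟨1, fun x => ?_⟩
      have h1 : (mult a x.2 : ℝ) ≤ x.2.length := by exact_mod_cast List.count_le_length
      have h0 : (0 : ℝ) ≤ mult a x.2 := Nat.cast_nonneg _
      dsimp only
      split_ifs
      · rw [mul_one, abs_of_nonneg h0]; linarith
      · rw [mul_zero, abs_zero]; linarith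
  have hone : ∀ x : 𝒳 × List 𝒳, |(fun _ => (1 : ℝ)) x| ≤ 1 * (1 + x.2.length) := fun x => by
    have h1 : (0 : ℝ) ≤ x.2.length := Nat.cast_nonneg _
    simp
  have hlen : ∀ x : 𝒳 × List 𝒳,
      |(fun x : 𝒳 × List 𝒳 => (x.2.length : ℝ)) x| ≤ 1 * (1 + x.2.length) := fun x => by
    simp
  have hK₁ : IsCompact (momentBall ψ L ∩ (fun ν : 𝒳 × List 𝒳 → ℝ => ∑' x, ν x * 1) ⁻¹' {1}) := by
    refine (isCompact_momentBall ψ L).of_isClosed_subset ?_ Set.inter_subset_left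
    exact (continuousOn_tsum_momentBall hψ hlin hone).preimage_isClosed_of_isClosed
      (isCompact_momentBall ψ L).isClosed isClosed_singleton
  have hind : Topology.IsInducing
      (fun ν : MSpace 𝒳 => fun f : offTests 𝒳 => ∑' x, ν.1 x * f.1 x) := ⟨rfl⟩
  rw [hind.isCompact_iff]
  have hcont : ContinuousOn
      (fun (ν : 𝒳 × List 𝒳 → ℝ) (f : offTests 𝒳) => ∑' x, ν x * f.1 x) (momentBall ψ L) :=
    continuousOn_pi.2 fun f =>
      let ⟨_, hM⟩ := hgrowth f
      continuousOn_tsum_momentBall hψ hlin hM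
  convert hK₁.image_of_continuousOn (hcont.mono Set.inter_subset_left) using 1
  ext φ
  constructor
  · rintro ⟨ν, hν, rfl⟩
    refine ⟨ν.1, ⟨⟨fun x _ => ⟨ν.2.nonneg x, ?_⟩, hν⟩, ?_⟩, rfl⟩
    · exact le_hasSum ν.2.hasSum x fun y _ => ν.2.nonneg y
    · simpa using ν.2.hasSum.tsum_eq
  · rintro ⟨ν, ⟨hν, hν1⟩, rfl⟩
    have hsum := momentBall.summable_mul hψ hlin hone hν
    have hmom := momentBall.summable_mul hψ hlin hlen hν
    refine ⟨⟨ν, momentBall.nonneg hν, ?_, ?_⟩, hν.2, rfl⟩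
    · have := hsum.hasSum
      rw [show ∑' x, ν x * (fun _ => (1 : ℝ)) x = 1 from hν1] at this
      simpa using this
    · simpa only [mul_comm] using hmom

end Compactness

section UpperBound

open PTree

variable {𝒳 : Type*}

theorem vertexProd_exp (f : 𝒳 → List 𝒳 → ℝ) (t : PTree 𝒳) :
    vertexProd (fun a c => Real.exp (f a c)) t =
      Real.exp (t.subtrees.map fun s => f s.root s.childLabels).sum := by
  unfold vertexProd
  induction t.subtrees with
  | nil => simp
  | cons s l ih => simp [Real.exp_add, ih]

theorem sum_mul_empOff_le [DecidableEq 𝒳] {f : 𝒳 → List 𝒳 → ℝ} (hf : ∀ a c, 0 ≤ f a c)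
    (F : Finset (𝒳 × List 𝒳)) (t : PTree 𝒳) :
    ∑ x ∈ F, f x.1 x.2 * empOff t x ≤
      (t.subtrees.map fun s => f s.root s.childLabels).sum / t.size := by
  simp only [empOff, mul_div_assoc']
  rw [← Finset.sum_div]
  gcongr
  induction t.subtrees with
  | nil => simp
  | cons s l ih =>
    have hcons : ∀ x : 𝒳 × List 𝒳,
        f x.1 x.2 * (((s :: l).filter fun s => s.root = x.1 ∧ s.childLabels = x.2).length : ℝ) =
          (if (s.root, s.childLabels) = x then f s.root s.childLabels else 0) +
          f x.1 x.2 * ((l.filter fun s => s.root = x.1 ∧ s.childLabels = x.2).length : ℝ) := by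
      rintro ⟨a, c⟩
      by_cases h : s.root = a ∧ s.childLabels = c
      · obtain ⟨rfl, rfl⟩ := h
        simp
        ring
      · simp [h]
    rw [Finset.sum_congr rfl fun x _ => hcons x, Finset.sum_add_distrib, List.map_cons,
      List.sum_cons]
    refine add_le_add ?_ ih
    rw [Finset.sum_ite_eq]
    split_ifs
    · exact le_rfl
    · exact hf _ _

/-- Chernoff bound for the sum over the vertices of a function of the offspring number. -/
theorem tsum_mgwWeight_le [Fintype 𝒳] {𝒬 : 𝒳 → List 𝒳 → ℝ} (hQ : ∀ a c, 0 ≤ 𝒬 a c) {ψ : ℕ → ℝ}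
    {M : ℝ≥0∞} (hM0 : M ≠ 0) (hMtop : M ≠ ∞)
    (hM : ∀ a, ∑' c : List 𝒳, ENNReal.ofReal (𝒬 a c * Real.exp (ψ c.length)) ≤ M)
    {μ0 : 𝒳 → ℝ} (hμ1 : ∀ a, μ0 a ≤ 1) (n : ℕ) (L : ℝ)
    (E : Set (PTree 𝒳)) [DecidablePred (· ∈ E)]
    (hE : ∀ t ∈ E, t.size = n →
      L * n ≤ (t.subtrees.map fun s => ψ s.childLabels.length).sum) :
    ∑' t : PTree 𝒳, (if t.size = n ∧ t ∈ E then ENNReal.ofReal (mgwWeight μ0 𝒬 t) else 0) ≤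
      ENNReal.ofReal (Real.exp (-(L * n))) * M ^ n * Fintype.card 𝒳 := by
  set q : 𝒳 → List 𝒳 → ℝ≥0∞ :=
    fun a c => ENNReal.ofReal (𝒬 a c * Real.exp (ψ c.length)) * M⁻¹ with hq
  have hq1 : ∀ a, ∑' c, q a c ≤ 1 := fun a => by
    rw [hq, ENNReal.tsum_mul_right, ← div_eq_mul_inv]
    exact ENNReal.div_le_of_le_mul (by simpa using hM a)
  refine le_trans ?_ (mul_le_mul_right (tsum_vertexProd_le_card hq1) _)
  rw [← ENNReal.tsum_mul_left]
  refine ENNReal.tsum_le_tsum fun t => ?_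
  split_ifs with ht
  swap
  · exact zero_le
  obtain ⟨rfl, htE⟩ := ht
  have hreal : mgwWeight μ0 𝒬 t ≤ Real.exp (-(L * t.size)) *
      vertexProd (fun a c => 𝒬 a c * Real.exp (ψ c.length)) t := by
    rw [vertexProd_mul, vertexProd_exp (fun _ c => ψ c.length)]
    have h1 : mgwWeight μ0 𝒬 t ≤ vertexProd 𝒬 t :=
      mul_le_of_le_one_left (vertexProd_nonneg hQ t) (hμ1 _)
    have h2 := hE t htE rfl
    set σ := (t.subtrees.map fun s => ψ s.childLabels.length).sum
    have h3 : 1 ≤ Real.exp (-(L * t.size)) * Real.exp σ := by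
      rw [← Real.exp_add]
      exact Real.one_le_exp (by linarith)
    calc mgwWeight μ0 𝒬 t ≤ vertexProd 𝒬 t * 1 := by simpa using h1
      _ ≤ vertexProd 𝒬 t * (Real.exp (-(L * t.size)) * Real.exp σ) :=
          mul_le_mul_of_nonneg_left h3 (vertexProd_nonneg hQ t)
      _ = _ := by ring
  refine (ENNReal.ofReal_le_ofReal hreal).trans (le_of_eq ?_)
  rw [ENNReal.ofReal_mul (Real.exp_pos _).le,
    ofReal_vertexProd fun a c => mul_nonneg (hQ _ _) (Real.exp_pos _).le, hq,
    vertexProd_mul _ (fun _ _ => M⁻¹), vertexProd_const, mul_assoc, mul_left_comm (M ^ _),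
    ← mul_pow, ENNReal.mul_inv_cancel hM0 hMtop, one_pow, mul_one]

end UpperBound

theorem elog_le_of_le_ofReal_exp {x : ℝ≥0∞} {r : ℝ} (h : x ≤ ENNReal.ofReal (Real.exp r)) :
    elog x ≤ (r : EReal) := by
  have htop : x ≠ ∞ := ne_top_of_le_ne_top ENNReal.ofReal_ne_top h
  unfold elog
  split_ifs with h0
  · exact bot_le
  · rw [EReal.coe_le_coe_iff]
    have hx : x.toReal ≤ Real.exp r := ENNReal.toReal_le_of_le_ofReal (Real.exp_pos _).le h
    exact (Real.log_le_iff_le_exp (ENNReal.toReal_pos h0 htop)).2 hx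

section Statement9

variable {𝒳 : Type*} [Fintype 𝒳] [DecidableEq 𝒳]

theorem exponential_tightness_empirical_offspring_measure
    (𝒬 : 𝒳 → List 𝒳 → ℝ) (h𝒬_nonneg : ∀ a c, 0 ≤ 𝒬 a c) (h𝒬_sum : ∀ a, HasSum (𝒬 a) 1)
    (hexp : ∀ (a : 𝒳) (η : ℝ), 0 < η →
      Summable (fun c : List 𝒳 => 𝒬 a c * Real.exp (η * c.length)))
    (Xr Xt : Finset 𝒳) (hWI : WeaklyIrred (meanMat 𝒬) Xr Xt)
    (htrans : BoundedTransient 𝒬 Xt)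
    (hcrit : CriticalKernel 𝒬)
    (μ0 : 𝒳 → ℝ) (hμ0_nonneg : ∀ a, 0 ≤ μ0 a) (hμ0_sum : ∑ a, μ0 a = 1)
    (hμ0r : 0 < ∑ a ∈ Xr, μ0 a)
    (S : Set ℕ) (hS : S = sizeSupport (mgwWeight μ0 𝒬)) :
    ∀ A : ℝ, 0 < A → ∃ K : Set (MSpace 𝒳), IsCompact K ∧
      Filter.limsup
        (fun n : ℕ => (((n : ℝ)⁻¹ : ℝ) : EReal) *
          elog (condP (mgwWeight μ0 𝒬) n
            {t | ∃ h : IsOffMeasure (empOff t), (⟨empOff t, h⟩ : MSpace 𝒳) ∈ Kᶜ}))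
        (Filter.atTop ⊓ Filter.principal S) ≤ ((-A : ℝ) : EReal) := by
  classical
  intro A _
  obtain ⟨ψ, hψ, hlin, hmom⟩ := exists_superlinear_moment h𝒬_nonneg h𝒬_sum hexp
  obtain ⟨ρ, hρ, hlower⟩ :=
    exists_pow_le_treeMass h𝒬_nonneg h𝒬_sum hexp hWI htrans hcrit hμ0_nonneg
  have hμ1 : ∀ a, μ0 a ≤ 1 := fun a => hμ0_sum ▸
    Finset.single_le_sum (fun b _ => hμ0_nonneg b) (Finset.mem_univ a)
  have hcard : (0 : ℝ) < Fintype.card 𝒳 := by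
    exact_mod_cast Fintype.card_pos_iff.2 hWI.npty.to_type
  set L := A + 1 + Real.log 3 - Real.log ρ with hL
  refine ⟨{ν | ∀ F : Finset (𝒳 × List 𝒳), ∑ x ∈ F, ψ x.2.length * ν.1 x ≤ L},
    isCompact_moment_le hψ hlin L, ?_⟩
  refine limsup_le_of_le (by isBoundedDefault) (eventually_inf_principal.2 ?_)
  obtain ⟨N, hN⟩ := exists_nat_ge (Real.log (Fintype.card 𝒳))
  filter_upwards [eventually_ge_atTop (max N 1)] with n hn hnS
  have hn0 : (0 : ℝ) < n := by exact_mod_cast (le_max_right N 1).trans hn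
  have hnN : (N : ℝ) ≤ n := by exact_mod_cast (le_max_left N 1).trans hn
  have hmass : ENNReal.ofReal (ρ ^ n) ≤ treeMass (mgwWeight μ0 𝒬) n :=
    hlower n (by rw [hS] at hnS; exact hnS)
  set K := {ν : MSpace 𝒳 | ∀ F : Finset (𝒳 × List 𝒳), ∑ x ∈ F, ψ x.2.length * ν.1 x ≤ L}
  set E := {t : PTree 𝒳 | ∃ h : IsOffMeasure (empOff t), (⟨empOff t, h⟩ : MSpace 𝒳) ∈ Kᶜ}
  have hE : ∀ t ∈ E, t.size = n →
      L * n ≤ (t.subtrees.map fun s => ψ s.childLabels.length).sum := by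
    rintro t ⟨h, ht⟩ rfl
    obtain ⟨F, hF⟩ := not_forall.1 ht
    have hle := sum_mul_empOff_le (f := fun _ c => ψ c.length) (fun _ c => hψ _) F t
    exact ((le_div_iff₀ hn0).1 ((not_le.1 hF).le.trans hle))
  have hcond : condP (mgwWeight μ0 𝒬) n E ≤
      ENNReal.ofReal (Real.exp (Real.log (Fintype.card 𝒳) - (A + 1) * n)) := by
    have hnum := tsum_mgwWeight_le h𝒬_nonneg (by norm_num) (by norm_num) hmom hμ1
      n L E hE
    calc condP (mgwWeight μ0 𝒬) n E
        ≤ (ENNReal.ofReal (Real.exp (-(L * n))) * 3 ^ n * Fintype.card 𝒳) /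
            ENNReal.ofReal (ρ ^ n) := ENNReal.div_le_div (by convert hnum) hmass
      _ = ENNReal.ofReal (Real.exp (-(L * n)) * 3 ^ n * Fintype.card 𝒳 / ρ ^ n) := by
          rw [ENNReal.ofReal_div_of_pos (by positivity), ENNReal.ofReal_mul (by positivity),
            ENNReal.ofReal_mul (by positivity), ENNReal.ofReal_natCast,
            ENNReal.ofReal_pow (show (0 : ℝ) ≤ 3 by norm_num), ENNReal.ofReal_ofNat]
      _ = _ := by
          congr 1
          have h3 : (3 : ℝ) ^ n = Real.exp (n * Real.log 3) := by
            rw [Real.exp_nat_mul, Real.exp_log (by norm_num)]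
          have hρn : ρ ^ n = Real.exp (n * Real.log ρ) := by
            rw [Real.exp_nat_mul, Real.exp_log hρ]
          rw [h3, hρn, ← Real.exp_log hcard, Real.log_exp, ← Real.exp_add, ← Real.exp_add,
            ← Real.exp_sub, hL]
          congr 1
          ring
  calc (((n : ℝ)⁻¹ : ℝ) : EReal) * elog (condP (mgwWeight μ0 𝒬) n E)
      ≤ (((n : ℝ)⁻¹ : ℝ) : EReal) *
          ((Real.log (Fintype.card 𝒳) - (A + 1) * n : ℝ) : EReal) :=
        mul_le_mul_of_nonneg_left (elog_le_of_le_ofReal_exp hcond)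
          (EReal.coe_nonneg.2 (inv_nonneg.2 hn0.le))
    _ ≤ ((-A : ℝ) : EReal) := by
        rw [← EReal.coe_mul, EReal.coe_le_coe_iff, inv_mul_le_iff₀ hn0]
        nlinarith

end Statement9
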